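/- arXiv:2010.08734 — 7 statements merged into one kernel-verified Lean document; each statement's English description precedes it below -/
import Mathlib

section
/- Let G = (ℤ/2ℤ)^t, v = 2^t, and let D₁ be a (v,k₁,λ₁)-difference set in G and D₂ ⊆ G. Then D₂ is a (v,k₁,λ₁)-difference set in G if and only if for every ξ = (ξ₁,…,ξ_t) ∈ {1,−1}^t: (i) if ξ_i = 1 for all i then Δ(D₁,D₂)(ξ) = 0; (ii) if ρ_G(D₁)(ξ) = √(k₁−λ₁) then Δ(D₁,D₂)(ξ) ∈ {0, 2√(k₁−λ₁)}; (iii) if ρ_G(D₁)(ξ) = −√(k₁−λ₁) then Δ(D₁,D₂)(ξ) ∈ {−2√(k₁−λ₁), 0}. -/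
/-- `D` is a `(v, k, λ)`-difference set in `G = (ℤ/2ℤ)^t`. -/
def IsDiffSet2 {t : ℕ} (k lam : ℕ) (D : Finset (Fin t → ZMod 2)) : Prop :=
  D.card = k ∧ ∀ g : Fin t → ZMod 2, g ≠ 0 →
    ((D ×ˢ D).filter (fun p => p.1 - p.2 = g)).card = lam

/-- `ρ_G(T)(ξ) = ∑_{(i₁,…,i_t) ∈ T} ξ₁^{i₁*} ⋯ ξ_t^{i_t*}`. -/
noncomputable def rho2 {t : ℕ} (T : Finset (Fin t → ZMod 2)) (ξ : Fin t → ℂ) : ℂ :=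
  ∑ i ∈ T, ∏ l, ξ l ^ ((i l).val)

/-- `Δ(D₁,D₂)(ξ) = ρ_G(D₁)(ξ) − ρ_G(D₂)(ξ)`. -/
noncomputable def Delta2 {t : ℕ} (D₁ D₂ : Finset (Fin t → ZMod 2)) (ξ : Fin t → ℂ) : ℂ :=
  rho2 D₁ ξ - rho2 D₂ ξ

/-- The number of ways to write `g` as a difference of two elements of `D`. -/
def diffCount {t : ℕ} (D : Finset (Fin t → ZMod 2)) (g : Fin t → ZMod 2) : ℕ :=
  ((D ×ˢ D).filter (fun p => p.1 - p.2 = g)).card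

/-- The monomial `ξ₁^{i₁*} ⋯ ξ_t^{i_t*}`, a character of `(ℤ/2ℤ)^t` in `i` when `ξ ∈ {1, -1}^t`. -/
noncomputable def signChar {t : ℕ} (ξ : Fin t → ℂ) (i : Fin t → ZMod 2) : ℂ :=
  ∏ l, ξ l ^ (i l).val

lemma signChar_sub {t : ℕ} {ξ : Fin t → ℂ} (hξ : ∀ i, ξ i = 1 ∨ ξ i = -1)
    (a b : Fin t → ZMod 2) : signChar ξ (a - b) = signChar ξ a * signChar ξ b := by
  have key : ∀ x y : ZMod 2, (-1 : ℂ) ^ (x - y).val = (-1) ^ x.val * (-1) ^ y.val := by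
    intro x y
    rw [← pow_add, neg_one_pow_eq_pow_mod_two, neg_one_pow_eq_pow_mod_two (n := x.val + y.val)]
    congr 1
    revert x y
    decide
  unfold signChar
  rw [← Finset.prod_mul_distrib]
  refine Finset.prod_congr rfl fun l _ => ?_
  rcases hξ l with h | h
  · simp [h]
  · rw [h]
    exact key (a l) (b l)

lemma signChar_zero {t : ℕ} (ξ : Fin t → ℂ) : signChar ξ 0 = 1 := by
  simp [signChar]

lemma signChar_of_forall_eq_one {t : ℕ} {ξ : Fin t → ℂ} (hξ : ∀ i, ξ i = 1)
    (a : Fin t → ZMod 2) : signChar ξ a = 1 := by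
  simp [signChar, hξ]

lemma sum_signChar_eq_zero {t : ℕ} {ξ : Fin t → ℂ} {l : Fin t} (hl : ξ l = -1) :
    ∑ g, signChar ξ g = 0 := by
  have h := Finset.prod_univ_sum (fun _ : Fin t => (Finset.univ : Finset (ZMod 2)))
    (fun l x => ξ l ^ x.val)
  rw [Fintype.piFinset_univ] at h
  unfold signChar
  rw [← h]
  refine Finset.prod_eq_zero (Finset.mem_univ l) ?_
  have : (Finset.univ : Finset (ZMod 2)) = {0, 1} := by decide
  rw [this, Finset.sum_pair (by decide), hl]
  simp [ZMod.val_one]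

/-- The set `{1, -1}^t` of sign vectors. -/
noncomputable def signVectors (t : ℕ) : Finset (Fin t → ℂ) :=
  Fintype.piFinset fun _ => {1, -1}

lemma mem_signVectors {t : ℕ} {ξ : Fin t → ℂ} :
    ξ ∈ signVectors t ↔ ∀ i, ξ i = 1 ∨ ξ i = -1 := by
  simp [signVectors]

lemma sum_signVectors_signChar {t : ℕ} (g : Fin t → ZMod 2) :
    ∑ ξ ∈ signVectors t, signChar ξ g = if g = 0 then 2 ^ t else 0 := by
  have hne : (1 : ℂ) ≠ -1 := by norm_num
  unfold signVectors signChar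
  rw [← Finset.prod_univ_sum (fun _ : Fin t => ({1, -1} : Finset ℂ)) (fun l x => x ^ (g l).val)]
  simp only [Finset.sum_pair hne, one_pow]
  split_ifs with hg
  · subst hg
    norm_num
  · obtain ⟨l, hl⟩ := Function.ne_iff.mp hg
    refine Finset.prod_eq_zero (Finset.mem_univ l) ?_
    have h1 : ∀ x : ZMod 2, x ≠ 0 → x.val = 1 := by decide
    rw [h1 _ hl]
    norm_num

/-- A function on `(ℤ/2ℤ)^t` all of whose Fourier coefficients vanish is zero. -/
lemma eq_zero_of_sum_mul_signChar {t : ℕ} {f : (Fin t → ZMod 2) → ℂ}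
    (hf : ∀ ξ : Fin t → ℂ, (∀ i, ξ i = 1 ∨ ξ i = -1) → ∑ h, f h * signChar ξ h = 0)
    (g : Fin t → ZMod 2) : f g = 0 := by
  have h1 : ∑ ξ ∈ signVectors t, ∑ h, f h * signChar ξ (h - g) = 0 := by
    refine Finset.sum_eq_zero fun ξ hξ => ?_
    rw [mem_signVectors] at hξ
    simp only [signChar_sub hξ, ← mul_assoc]
    rw [← Finset.sum_mul, hf ξ hξ, zero_mul]
  rw [Finset.sum_comm] at h1
  simp only [← Finset.mul_sum, sum_signVectors_signChar, sub_eq_zero] at h1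
  simpa using h1

lemma rho2_sq {t : ℕ} (D : Finset (Fin t → ZMod 2)) {ξ : Fin t → ℂ}
    (hξ : ∀ i, ξ i = 1 ∨ ξ i = -1) :
    rho2 D ξ ^ 2 = ∑ g, (diffCount D g : ℂ) * signChar ξ g := by
  have h1 : rho2 D ξ ^ 2 = ∑ p ∈ D ×ˢ D, signChar ξ (p.1 - p.2) := by
    simp only [signChar_sub hξ]
    rw [sq, rho2, Finset.sum_mul_sum, Finset.sum_product]
    rfl
  rw [h1, ← Finset.sum_fiberwise (D ×ˢ D) (fun p => p.1 - p.2)]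
  refine Finset.sum_congr rfl fun g _ => ?_
  rw [Finset.sum_congr rfl (g := fun _ => signChar ξ g)
    (fun p hp => by rw [(Finset.mem_filter.mp hp).2])]
  simp [diffCount]

lemma diffCount_zero {t : ℕ} (D : Finset (Fin t → ZMod 2)) : diffCount D 0 = D.card := by
  simp only [diffCount, sub_eq_zero]
  rw [← Finset.diag_card D]
  congr 1
  ext ⟨a, b⟩
  simp only [Finset.mem_filter, Finset.mem_product, Finset.mem_diag]
  constructor
  · rintro ⟨⟨h, -⟩, h'⟩
    exact ⟨h, h'⟩
  · rintro ⟨h, rfl⟩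
    exact ⟨⟨h, h⟩, rfl⟩

lemma diffCount_le_card {t : ℕ} (D : Finset (Fin t → ZMod 2)) (g : Fin t → ZMod 2) :
    diffCount D g ≤ D.card := by
  refine Finset.card_le_card_of_injOn Prod.fst ?_ ?_
  · intro p hp
    simp only [Finset.coe_filter, Finset.mem_product, Set.mem_ofPred_eq] at hp
    exact hp.1.1
  · intro p hp q hq h
    simp only [Finset.coe_filter, Set.mem_ofPred_eq] at hp hq
    refine Prod.ext h ?_
    have := hp.2.trans hq.2.symm
    rw [h] at this
    exact sub_right_injective this

lemma rho2_of_forall_eq_one {t : ℕ} (D : Finset (Fin t → ZMod 2)) {ξ : Fin t → ℂ}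
    (hξ : ∀ i, ξ i = 1) : rho2 D ξ = D.card := by
  simp [rho2, hξ]

lemma IsDiffSet2.rho2_sq {t k lam : ℕ} {D : Finset (Fin t → ZMod 2)} (hD : IsDiffSet2 k lam D)
    {ξ : Fin t → ℂ} (hξ : ∀ i, ξ i = 1 ∨ ξ i = -1) {l : Fin t} (hl : ξ l = -1) :
    rho2 D ξ ^ 2 = (Real.sqrt ((k : ℝ) - lam) : ℂ) ^ 2 := by
  have hle : lam ≤ k := by
    have hg : (Pi.single l 1 : Fin t → ZMod 2) ≠ 0 := by simp
    rw [← hD.2 _ hg, ← hD.1]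
    exact diffCount_le_card D _
  have hs : (Real.sqrt ((k : ℝ) - lam) : ℂ) ^ 2 = (k : ℂ) - lam := by
    have h0 : (0 : ℝ) ≤ (k : ℝ) - lam := sub_nonneg.mpr (by exact_mod_cast hle)
    rw [← Complex.ofReal_pow, Real.sq_sqrt h0]
    push_cast
    rfl
  have hcount : ∀ g, (diffCount D g : ℂ) * signChar ξ g =
      lam * signChar ξ g + if g = 0 then (k : ℂ) - lam else 0 := by
    intro g
    split_ifs with hg
    · subst hg
      rw [diffCount_zero, hD.1, signChar_zero]
      ring
    · rw [show diffCount D g = lam from hD.2 g hg, add_zero]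
  rw [_root_.rho2_sq D hξ, hs, Finset.sum_congr rfl fun g _ => hcount g, Finset.sum_add_distrib,
    ← Finset.mul_sum, sum_signChar_eq_zero hl]
  simp

lemma diffCount_eq_of_rho2_sq_eq {t : ℕ} {D₁ D₂ : Finset (Fin t → ZMod 2)}
    (h : ∀ ξ : Fin t → ℂ, (∀ i, ξ i = 1 ∨ ξ i = -1) → rho2 D₁ ξ ^ 2 = rho2 D₂ ξ ^ 2)
    (g : Fin t → ZMod 2) : diffCount D₁ g = diffCount D₂ g := by
  have := eq_zero_of_sum_mul_signChar
    (f := fun g => (diffCount D₁ g : ℂ) - diffCount D₂ g) (fun ξ hξ => by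
      simp only [sub_mul]
      rw [Finset.sum_sub_distrib, ← rho2_sq D₁ hξ, ← rho2_sq D₂ hξ, h ξ hξ, sub_self]) g
  exact_mod_cast sub_eq_zero.mp this

/-- exchange criterion, same parameters. -/
theorem stmt_3 (t v k₁ lam₁ : ℕ) (hv : v = 2 ^ t)
    (D₁ D₂ : Finset (Fin t → ZMod 2)) (hD₁ : IsDiffSet2 k₁ lam₁ D₁) :
    IsDiffSet2 k₁ lam₁ D₂ ↔
      ∀ ξ : Fin t → ℂ, (∀ i, ξ i = 1 ∨ ξ i = -1) →
        (((∀ i, ξ i = 1) → Delta2 D₁ D₂ ξ = 0) ∧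
          (rho2 D₁ ξ = (Real.sqrt ((k₁ : ℝ) - lam₁) : ℂ) →
            Delta2 D₁ D₂ ξ ∈
              ({0, 2 * (Real.sqrt ((k₁ : ℝ) - lam₁) : ℂ)} : Set ℂ)) ∧
          (rho2 D₁ ξ = -(Real.sqrt ((k₁ : ℝ) - lam₁) : ℂ) →
            Delta2 D₁ D₂ ξ ∈
              ({-(2 * (Real.sqrt ((k₁ : ℝ) - lam₁) : ℂ)), 0} : Set ℂ))) := by
  constructor
  · intro hD₂ ξ hξ
    by_cases h1 : ∀ i, ξ i = 1
    · have h0 : Delta2 D₁ D₂ ξ = 0 := by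
        rw [Delta2, rho2_of_forall_eq_one D₁ h1, rho2_of_forall_eq_one D₂ h1, hD₁.1, hD₂.1,
          sub_self]
      simp [h0]
    · obtain ⟨l, hl⟩ := not_forall.mp h1
      have hD := sq_eq_sq_iff_eq_or_eq_neg.mp (hD₂.rho2_sq hξ ((hξ l).resolve_left hl))
      refine ⟨fun h => absurd h h1, fun h => ?_, fun h => ?_⟩
      · rw [Delta2, h]
        rcases hD with h2 | h2 <;> rw [h2]
        · exact Or.inl (sub_self _)
        · refine Or.inr ?_
          rw [Set.mem_singleton_iff]
          ring
      · rw [Delta2, h]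
        rcases hD with h2 | h2 <;> rw [h2]
        · left
          ring
        · exact Or.inr (sub_self _)
  · intro H
    have hcard : D₂.card = k₁ := by
      have h := (H (fun _ => 1) (fun _ => Or.inl rfl)).1 (fun _ => rfl)
      rw [Delta2, rho2_of_forall_eq_one D₁ (fun _ => rfl),
        rho2_of_forall_eq_one D₂ (fun _ => rfl), hD₁.1, sub_eq_zero] at h
      exact_mod_cast h.symm
    refine ⟨hcard, fun g hg => ?_⟩
    rw [← hD₁.2 g hg]
    refine diffCount_eq_of_rho2_sq_eq (fun ξ hξ => ?_) g
    obtain ⟨hone, hpos, hneg⟩ := H ξ hξ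
    by_cases h1 : ∀ i, ξ i = 1
    · rw [sub_eq_zero.mp (hone h1)]
    · obtain ⟨l, hl⟩ := not_forall.mp h1
      rcases sq_eq_sq_iff_eq_or_eq_neg.mp (hD₁.rho2_sq hξ ((hξ l).resolve_left hl)) with h | h
      · rcases hpos h with h2 | h2
        · rw [sub_eq_zero.mp h2]
        · rw [Set.mem_singleton_iff, Delta2, h] at h2
          rw [h, show rho2 D₂ ξ = -(Real.sqrt ((k₁ : ℝ) - lam₁) : ℂ) by linear_combination -h2]
          ring
      · rcases hneg h with h2 | h2
        · rw [Delta2, h] at h2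
          rw [h, show rho2 D₂ ξ = (Real.sqrt ((k₁ : ℝ) - lam₁) : ℂ) by linear_combination -h2]
          ring
        · rw [sub_eq_zero.mp h2]
end

section
/- Let m ≥ 2 and 1 ≤ s ≤ m be integers, let P ∈ 𝔽₂[X₂,…,X_m], let π : 𝔽₂^m → 𝔽₂^m be the permutation π(x₁,…,x_m) = (x₁ + P(x₂,…,x_m), x₂,…,x_m), and let L = {(x₁,…,x_s,0,…,0) : x_i ∈ 𝔽₂} ⊆ 𝔽₂^m. Then (π, L) satisfies the C-condition; in fact for every a ∈ 𝔽₂^m with a_j = 0 for j ≤ s, π⁻¹(a+L) − π⁻¹(a) = L. -/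
/-- A nonempty subset `F ⊆ 𝔽₂^m` is a flat iff it is a coset of an `𝔽₂`-subspace. -/
def IsFlat {m : ℕ} (F : Set (Fin m → ZMod 2)) : Prop :=
  ∃ (W : Submodule (ZMod 2) (Fin m → ZMod 2)) (b : Fin m → ZMod 2),
    F = (fun w => b + w) '' (W : Set (Fin m → ZMod 2))

/-- for `L = {(x₁,…,x_s,0,…,0)}` and `π(x) = (x₁ + P(x₂,…,x_m), x₂,…,x_m)`,
the pair `(π, L)` satisfies the C-condition; in fact `π⁻¹(a+L) − π⁻¹(a) = L` whenever
`a_j = 0` for `j ≤ s`. (Coordinates are 0-indexed: `x j` is `x_{j+1}`.) -/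
theorem stmt_4 (m s : ℕ) [NeZero m] (hm : 2 ≤ m) (hs1 : 1 ≤ s) (hsm : s ≤ m)
    (P : MvPolynomial (Fin m) (ZMod 2))
    (hP : P ∈ MvPolynomial.supported (ZMod 2) {i : Fin m | i ≠ 0})
    (π : Equiv.Perm (Fin m → ZMod 2))
    (hπ : ∀ x, π x = Function.update x 0 (x 0 + MvPolynomial.eval x P))
    (L : Set (Fin m → ZMod 2))
    (hL : L = {x | ∀ j : Fin m, s ≤ (j : ℕ) → x j = 0}) :
    (∀ a : Fin m → ZMod 2, IsFlat (⇑π ⁻¹' ((a + ·) '' L))) ∧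
    (∀ a : Fin m → ZMod 2, (∀ j : Fin m, (j : ℕ) < s → a j = 0) →
      (· - π.symm a) '' (⇑π ⁻¹' ((a + ·) '' L)) = L) := by
  subst hL
  have hfix (x : Fin m → ZMod 2) (j : Fin m) (hj : s ≤ (j : ℕ)) : π x j = x j := by
    rw [hπ, Function.update_of_ne]
    rintro rfl
    simp at hj
    omega
  have hsymm (a : Fin m → ZMod 2) (j : Fin m) (hj : s ≤ (j : ℕ)) : π.symm a j = a j := by
    rw [← hfix (π.symm a) j hj, π.apply_symm_apply]
  have hpre (a x : Fin m → ZMod 2) :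
      x ∈ ⇑π ⁻¹' ((a + ·) '' {x | ∀ j : Fin m, s ≤ (j : ℕ) → x j = 0}) ↔
        ∀ j : Fin m, s ≤ (j : ℕ) → x j = a j := by
    simp only [Set.image_add_left, Set.mem_preimage, Set.mem_ofPred_eq, Pi.add_apply,
      Pi.neg_apply, neg_add_eq_zero]
    exact forall₂_congr fun j hj => by rw [hfix x j hj, eq_comm]
  refine ⟨fun a => ⟨⨅ j : {j : Fin m // s ≤ (j : ℕ)},
    LinearMap.ker (LinearMap.proj (R := ZMod 2) (φ := fun _ : Fin m => ZMod 2) j.1), a, ?_⟩,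
    fun a _ => ?_⟩
  · ext x
    rw [hpre]
    simp [CharTwo.add_eq_zero, eq_comm]
  · ext y
    refine ⟨?_, fun hy => ⟨y + π.symm a, (hpre _ _).2 fun j hj => ?_, add_sub_cancel_right _ _⟩⟩
    · rintro ⟨x, hx, rfl⟩ j hj
      simp [(hpre _ _).1 hx j hj, hsymm a j hj]
    · simp [hy j hj, hsymm a j hj]
end

section
/- Let m ≥ 2 and 1 ≤ s ≤ m be integers, let P = ∑ α_{i₁⋯i_ℓ} X_{i₁}⋯X_{i_ℓ} ∈ 𝔽₂[X₂,…,X_m] be a multilinear polynomial (sum over 0 ≤ ℓ ≤ m−1 and 2 ≤ i₁ < ⋯ < i_ℓ ≤ m), let π : 𝔽₂^m → 𝔽₂^m be the permutation π(x₁,…,x_m) = (x₁ + P(x₂,…,x_m), x₂,…,x_m), and let L = {(0,…,0,x_{s+1},…,x_m) : x_i ∈ 𝔽₂} ⊆ 𝔽₂^m (first s coordinates zero). If α_{i₁⋯i_ℓ} = 0 for every index tuple (i₁,…,i_ℓ) with |{j : i_j > s}| ≥ 2, then (π, L) satisfies the C-condition. -/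
/-- A nonempty subset of `𝔽₂^m` closed under sums of three elements is a flat. -/
theorem isFlat_of_add_add_mem {m : ℕ} {F : Set (Fin m → ZMod 2)} (hne : F.Nonempty)
    (hF : ∀ x ∈ F, ∀ y ∈ F, ∀ z ∈ F, x + y + z ∈ F) : IsFlat F := by
  obtain ⟨b, hb⟩ := hne
  refine ⟨{ carrier := {w | b + w ∈ F}, zero_mem' := ?_, add_mem' := ?_, smul_mem' := ?_ }, b, ?_⟩
  · intro u v hu hv
    have h := hF _ hu _ hv _ hb
    have e : b + u + (b + v) + b = b + (u + v) := by
      rw [show b + u + (b + v) + b = b + (u + v) + (b + b) by abel,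
        show b + b = 0 from funext fun i => CharTwo.add_self_eq_zero (b i), add_zero]
    rwa [e] at h
  · simpa using hb
  · intro c w hw
    obtain rfl | rfl : c = 0 ∨ c = 1 := by revert c; decide
    · simpa using hb
    · simpa using hw
  · ext x
    constructor
    · intro hx
      exact ⟨x - b, by simpa using hx, by simp⟩
    · rintro ⟨w, hw, rfl⟩
      exact hw

/-- A monomial which is linear in one variable of `S` and free of the others is affine along
points agreeing outside `S`. -/
theorem prod_pow_add_add {ι : Type*} [DecidableEq ι] (d : ι →₀ ℕ) (S : ι → Prop)
    [DecidablePred S] (hd : ∀ i, d i ≤ 1) (hS : (d.support.filter S).card ≤ 1)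
    {x y z : ι → ZMod 2} (hxy : ∀ i ∈ d.support, ¬ S i → x i = y i)
    (hxz : ∀ i ∈ d.support, ¬ S i → x i = z i) :
    ∏ i ∈ d.support, (x + y + z) i ^ d i =
      ∏ i ∈ d.support, x i ^ d i + ∏ i ∈ d.support, y i ^ d i + ∏ i ∈ d.support, z i ^ d i := by
  have hsum : ∀ i ∈ d.support, ¬ S i → (x + y + z) i = x i := fun i hi hiS => by
    simp [← hxy i hi hiS, ← hxz i hi hiS, CharTwo.add_self_eq_zero]
  have hprod : ∀ w : ι → ZMod 2, (∀ i ∈ d.support, ¬ S i → w i = x i) →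
      ∏ i ∈ d.support with ¬ S i, w i ^ d i = ∏ i ∈ d.support with ¬ S i, x i ^ d i :=
    fun w hw => Finset.prod_congr rfl fun i hi => by
      rw [hw i (Finset.mem_filter.1 hi).1 (Finset.mem_filter.1 hi).2]
  simp only [← Finset.prod_filter_mul_prod_filter_not d.support S]
  rw [hprod _ hsum, hprod y fun i hi h => (hxy i hi h).symm,
    hprod z fun i hi h => (hxz i hi h).symm, ← add_mul, ← add_mul]
  congr 1
  obtain h | h := Nat.le_one_iff_eq_zero_or_eq_one.1 hS
  · rw [Finset.card_eq_zero.1 h]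
    simp only [Finset.prod_empty]
    decide
  · obtain ⟨k, hk⟩ := Finset.card_eq_one.1 h
    have hkd : k ∈ d.support := Finset.filter_subset S _ (hk ▸ Finset.mem_singleton_self k)
    have hk1 : d k = 1 := le_antisymm (hd k) (Nat.one_le_iff_ne_zero.2 (by simpa using hkd))
    simp [hk, hk1]

/-- with `L = {(0,…,0,x_{s+1},…,x_m)}`, if the multilinear polynomial `P`
(in `X₂,…,X_m`) has no monomial containing at least two variables `X_i` with `i > s`,
then `(π, L)` satisfies the C-condition, where `π(x) = (x₁ + P(x₂,…,x_m), x₂,…,x_m)`.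
(Coordinates are 0-indexed: `x j` is `x_{j+1}`, so `X_i` for `i > s` has index `≥ s`.) -/
theorem stmt_5 (m s : ℕ) [NeZero m] (hm : 2 ≤ m) (hs1 : 1 ≤ s) (hsm : s ≤ m)
    (P : MvPolynomial (Fin m) (ZMod 2))
    (hP0 : ∀ d ∈ P.support, (d : (Fin m →₀ ℕ)) 0 = 0)
    (hPml : ∀ d ∈ P.support, ∀ i, (d : (Fin m →₀ ℕ)) i ≤ 1)
    (halpha : ∀ d ∈ P.support,
      ((d : (Fin m →₀ ℕ)).support.filter (fun i : Fin m => s ≤ (i : ℕ))).card ≤ 1)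
    (L : Set (Fin m → ZMod 2))
    (hL : L = {x | ∀ j : Fin m, (j : ℕ) < s → x j = 0}) :
    ∀ a : Fin m → ZMod 2,
      IsFlat ((fun x => Function.update x 0 (x 0 + MvPolynomial.eval x P)) ⁻¹'
        ((a + ·) '' L)) := by
  intro a
  have hmem : ∀ x, x ∈ ((fun x => Function.update x 0 (x 0 + MvPolynomial.eval x P)) ⁻¹'
      ((a + ·) '' L)) ↔ x 0 + MvPolynomial.eval x P = a 0 ∧
        ∀ j : Fin m, j ≠ 0 → (j : ℕ) < s → x j = a j := by
    intro x
    have h0 : ((0 : Fin m) : ℕ) < s := by simpa using Nat.lt_of_succ_le hs1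
    simp only [hL, Set.mem_preimage, Set.image_add_left, Set.mem_ofPred_eq, Pi.add_apply,
      Pi.neg_apply, neg_add_eq_zero]
    constructor
    · intro h
      refine ⟨by simpa using (h 0 h0).symm, fun j hj hjs => ?_⟩
      simpa [hj] using (h j hjs).symm
    · rintro ⟨h1, h2⟩ j hjs
      by_cases hj : j = 0
      · subst hj
        simpa using h1.symm
      · simpa [hj] using (h2 j hj hjs).symm
  have hne0 : ∀ d ∈ P.support, ∀ i ∈ d.support, i ≠ 0 := by
    rintro d hd i hi rfl
    exact (Finsupp.mem_support_iff.1 hi) (hP0 d hd)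
  apply isFlat_of_add_add_mem
  · refine ⟨Function.update a 0 (a 0 + MvPolynomial.eval a P), (hmem _).2 ⟨?_, ?_⟩⟩
    · have h : MvPolynomial.eval (Function.update a 0 (a 0 + MvPolynomial.eval a P)) P =
          MvPolynomial.eval a P := by
        rw [MvPolynomial.eval_eq, MvPolynomial.eval_eq]
        refine Finset.sum_congr rfl fun d hd => ?_
        congr 1
        refine Finset.prod_congr rfl fun i hi => ?_
        rw [Function.update_of_ne (hne0 d hd i hi)]
      rw [h, Function.update_self, add_assoc, CharTwo.add_self_eq_zero, add_zero]
    · intro j hj _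
      exact Function.update_of_ne hj _ _
  · intro x hx y hy z hz
    rw [hmem] at hx hy hz ⊢
    have h : MvPolynomial.eval (x + y + z) P =
        MvPolynomial.eval x P + MvPolynomial.eval y P + MvPolynomial.eval z P := by
      simp only [MvPolynomial.eval_eq, ← Finset.sum_add_distrib, ← mul_add]
      refine Finset.sum_congr rfl fun d hd => ?_
      congr 1
      refine prod_pow_add_add d (fun i : Fin m => s ≤ (i : ℕ)) (hPml d hd) (halpha d hd) ?_ ?_
      · intro i hi his
        rw [hx.2 i (hne0 d hd i hi) (not_le.1 his), hy.2 i (hne0 d hd i hi) (not_le.1 his)]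
      · intro i hi his
        rw [hx.2 i (hne0 d hd i hi) (not_le.1 his), hz.2 i (hne0 d hd i hi) (not_le.1 his)]
    refine ⟨?_, fun j hj hjs => ?_⟩
    · calc (x + y + z) 0 + MvPolynomial.eval (x + y + z) P
          = (x 0 + MvPolynomial.eval x P) + (y 0 + MvPolynomial.eval y P) +
              (z 0 + MvPolynomial.eval z P) := by
            rw [h, Pi.add_apply, Pi.add_apply]
            ring
        _ = a 0 := by
            rw [hx.1, hy.1, hz.1, CharTwo.add_self_eq_zero, zero_add]
    · rw [Pi.add_apply, Pi.add_apply, hx.2 j hj hjs, hy.2 j hj hjs, hz.2 j hj hjs,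
        CharTwo.add_self_eq_zero, zero_add]
end

section
/- Let m ≥ 2 and 1 ≤ s ≤ m be integers, let P = ∑ α_{i₁⋯i_ℓ} X_{i₁}⋯X_{i_ℓ} ∈ 𝔽₂[X₂,…,X_m] be a multilinear polynomial (sum over 0 ≤ ℓ ≤ m−1 and 2 ≤ i₁ < ⋯ < i_ℓ ≤ m), let π : 𝔽₂^m → 𝔽₂^m be the permutation π(x₁,…,x_m) = (x₁ + P(x₂,…,x_m), x₂,…,x_m), and let L = {(0,…,0,x_{s+1},…,x_m) : x_i ∈ 𝔽₂} ⊆ 𝔽₂^m (first s coordinates zero). If α_{i₁⋯i_ℓ} = 1 for some index tuple (i₁,…,i_ℓ) with |{j : i_j > s}| ≥ 2, then (π, L) does not satisfy the C-condition, i.e. there exists a ∈ 𝔽₂^m such that π⁻¹(a + L) is not a flat. -/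
theorem IsFlat.sub_add_mem {m : ℕ} {F : Set (Fin m → ZMod 2)} (hF : IsFlat F)
    {x y z : Fin m → ZMod 2} (hx : x ∈ F) (hy : y ∈ F) (hz : z ∈ F) : x - y + z ∈ F := by
  obtain ⟨W, b, rfl⟩ := hF
  obtain ⟨u, hu, rfl⟩ := hx
  obtain ⟨v, hv, rfl⟩ := hy
  obtain ⟨w, hw, rfl⟩ := hz
  exact ⟨u - v + w, W.add_mem (W.sub_mem hu hv) hw, by dsimp only; abel⟩

namespace MvPolynomial

/-- The value of a polynomial at the characteristic vector of `A` is the sum of the coefficients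
of the monomials supported in `A`. -/
theorem eval_ite_mem {σ R : Type*} [Fintype σ] [DecidableEq σ] [CommSemiring R]
    (P : MvPolynomial σ R) (A : Finset σ) :
    eval (fun k => if k ∈ A then 1 else 0) P =
      ∑ e ∈ P.support, if e.support ⊆ A then P.coeff e else 0 := by
  rw [eval_eq]
  refine Finset.sum_congr rfl fun e _ => ?_
  split_ifs with h
  · rw [Finset.prod_eq_one, mul_one]
    intro k hk
    rw [if_pos (h hk), one_pow]
  · obtain ⟨k, hk, hkA⟩ := Finset.not_subset.mp h
    rw [Finset.prod_eq_zero hk, mul_zero]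
    rw [if_neg hkA, zero_pow (Finsupp.mem_support_iff.mp hk)]

/-- A polynomial not involving the variable `i` takes equal values at points that agree
away from `i`. -/
theorem eval_eq_of_eq_off {σ R : Type*} [CommSemiring R] (P : MvPolynomial σ R) (i : σ)
    (hP : ∀ d ∈ P.support, d i = 0) {x y : σ → R} (hxy : ∀ k, k ≠ i → x k = y k) :
    eval x P = eval y P := by
  rw [eval_eq, eval_eq]
  refine Finset.sum_congr rfl fun e he => ?_
  congr 1
  refine Finset.prod_congr rfl fun k hk => ?_
  rw [hxy k]
  rintro rfl
  exact Finsupp.mem_support_iff.mp hk (hP e he)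

/-- If a multilinear polynomial has a monomial divisible by `X i * X j`, then its second derivative
in the directions `i`, `j` does not vanish identically. -/
theorem exists_second_difference_ne_zero {σ R : Type*} [Fintype σ] [DecidableEq σ] [CommRing R]
    (P : MvPolynomial σ R) (hP : ∀ d ∈ P.support, ∀ k, d k ≤ 1) {i j : σ}
    (h : ∃ d ∈ P.support, i ∈ d.support ∧ j ∈ d.support) :
    ∃ d ∈ P.support, i ∈ d.support ∧ j ∈ d.support ∧
      eval (fun k => if k ∈ d.support then 1 else 0) P
        - eval (fun k => if k ∈ d.support.erase i then 1 else 0) P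
        - eval (fun k => if k ∈ d.support.erase j then 1 else 0) P
        + eval (fun k => if k ∈ (d.support.erase i).erase j then 1 else 0) P ≠ 0 := by
  obtain ⟨d, hd⟩ := (P.support.filter fun d => i ∈ d.support ∧ j ∈ d.support).exists_minimal
    (by obtain ⟨d, hd, hij⟩ := h; exact ⟨d, Finset.mem_filter.mpr ⟨hd, hij⟩⟩)
  obtain ⟨hdP, hi, hj⟩ := Finset.mem_filter.mp hd.prop
  refine ⟨d, hdP, hi, hj, ?_⟩
  simp only [eval_ite_mem, ← Finset.sum_sub_distrib, ← Finset.sum_add_distrib]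
  rw [Finset.sum_eq_single_of_mem d hdP]
  · simpa [Finset.subset_erase, hi, hj] using hdP
  · intro e he hed
    simp only [Finset.subset_erase]
    by_cases hsub : e.support ⊆ d.support
    · have hle : e ≤ d := fun k => by
        by_cases hk : k ∈ e.support
        · exact (hP e he k).trans
            (Nat.one_le_iff_ne_zero.mpr (Finsupp.mem_support_iff.mp (hsub hk)))
        · rw [Finsupp.notMem_support_iff.mp hk]
          exact Nat.zero_le _
      have hnot : ¬(i ∈ e.support ∧ j ∈ e.support) := fun hij =>
        hed (hle.antisymm (hd.le_of_le (Finset.mem_filter.mpr ⟨he, hij⟩) hle))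
      by_cases hie : i ∈ e.support <;> by_cases hje : j ∈ e.support <;> simp_all
    · simp [hsub]

end MvPolynomial

/-- with `L = {(0,…,0,x_{s+1},…,x_m)}`, if the multilinear polynomial `P`
(in `X₂,…,X_m`) has some monomial containing at least two variables `X_i` with `i > s`,
then `(π, L)` does not satisfy the C-condition: there is `a` with `π⁻¹(a+L)` not a flat,
where `π(x) = (x₁ + P(x₂,…,x_m), x₂,…,x_m)`.
(Coordinates are 0-indexed: `x j` is `x_{j+1}`, so `X_i` for `i > s` has index `≥ s`.) -/
theorem stmt_6 (m s : ℕ) [NeZero m] (hm : 2 ≤ m) (hs1 : 1 ≤ s) (hsm : s ≤ m)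
    (P : MvPolynomial (Fin m) (ZMod 2))
    (hP0 : ∀ d ∈ P.support, (d : (Fin m →₀ ℕ)) 0 = 0)
    (hPml : ∀ d ∈ P.support, ∀ i, (d : (Fin m →₀ ℕ)) i ≤ 1)
    (halpha : ∃ d ∈ P.support,
      2 ≤ ((d : (Fin m →₀ ℕ)).support.filter (fun i : Fin m => s ≤ (i : ℕ))).card)
    (L : Set (Fin m → ZMod 2))
    (hL : L = {x | ∀ j : Fin m, (j : ℕ) < s → x j = 0}) :
    ∃ a : Fin m → ZMod 2,
      ¬ IsFlat ((fun x => Function.update x 0 (x 0 + MvPolynomial.eval x P)) ⁻¹'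
        ((a + ·) '' L)) := by
  subst hL
  obtain ⟨d₀, hd₀, hcard⟩ := halpha
  obtain ⟨i, hi₀, j, hj₀, hij⟩ := Finset.one_lt_card.mp hcard
  obtain ⟨hi₀, his⟩ := Finset.mem_filter.mp hi₀
  obtain ⟨hj₀, hjs⟩ := Finset.mem_filter.mp hj₀
  obtain ⟨d, hd, hi, hj, hne⟩ :=
    P.exists_second_difference_ne_zero hPml ⟨d₀, hd₀, hi₀, hj₀⟩
  let c : Finset (Fin m) → Fin m → ZMod 2 := fun A k => if k ∈ A then 1 else 0
  refine ⟨c d.support, fun hF => hne ?_⟩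
  let p : Finset (Fin m) → Fin m → ZMod 2 := fun A => Function.update (c A) 0
    (c d.support 0 + MvPolynomial.eval (c A) P)
  have hp (A : Finset (Fin m)) (hA : ∀ k : Fin m, (k : ℕ) < s → (k ∈ A ↔ k ∈ d.support)) :
      p A ∈ (fun x => Function.update x 0 (x 0 + MvPolynomial.eval x P)) ⁻¹'
        ((c d.support + ·) '' {x | ∀ j : Fin m, (j : ℕ) < s → x j = 0}) := by
    have hev : MvPolynomial.eval (p A) P = MvPolynomial.eval (c A) P :=
      P.eval_eq_of_eq_off 0 hP0 fun k hk => Function.update_of_ne hk _ _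
    refine ⟨_, fun k hk => ?_, add_sub_cancel (c d.support) _⟩
    rw [Pi.sub_apply]
    beta_reduce
    rw [hev]
    by_cases hk0 : k = 0
    · subst hk0
      simp only [p, Function.update_self, add_assoc, CharTwo.add_self_eq_zero, add_zero, sub_self]
    · simp [p, hk0, c, hA k hk]
  have herase {k l : Fin m} (hl : s ≤ (l : ℕ)) (hk : (k : ℕ) < s) : k ≠ l := by
    rintro rfl
    omega
  obtain ⟨y, hy, hyq⟩ := hF.sub_add_mem (hp d.support fun _ _ => Iff.rfl)
    (hp (d.support.erase i) fun k hk => by simp [herase his hk])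
    (hp (d.support.erase j) fun k hk => by simp [herase hjs hk])
  have hev : MvPolynomial.eval (p d.support - p (d.support.erase i) + p (d.support.erase j)) P =
      MvPolynomial.eval (c ((d.support.erase i).erase j)) P := by
    refine P.eval_eq_of_eq_off 0 hP0 fun k hk => ?_
    by_cases hki : k = i
    · subst hki
      simp_all [p, c, CharTwo.add_self_eq_zero]
    by_cases hkj : k = j
    · subst hkj
      simp_all [p, c]
    simp [p, c, hk, hki, hkj]
  have h0 := congrFun hyq 0
  beta_reduce at h0
  rw [hev] at h0
  simp only [Pi.add_apply, Pi.sub_apply, Function.update_self, p,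
    hy 0 (by simpa using Nat.lt_of_lt_of_le Nat.zero_lt_one hs1), add_zero] at h0
  simp only [CharTwo.sub_eq_add] at h0 ⊢
  linear_combination -h0 - CharTwo.add_self_eq_zero (c d.support 0)
end

section
/- Let m ≥ 3 and 1 ≤ r ≤ s ≤ m−2 be integers, let L = {(0,…,0,x_{s+1},…,x_m) : x_i ∈ 𝔽₂} ⊆ 𝔽₂^m (first s coordinates zero), let π(x₁,…,x_m) = (x₁ + ∏_{i=r+1}^{m} x_i, x₂,…,x_m), let D_{(π,L)} ⊆ 𝔽₂^{2m} be the support of f_{(π,L)} and D ⊆ 𝔽₂^{2m} the support of f(x,y) = ∑_{i=1}^{m} x_i y_i + ∏_{i=s+1}^{m}(x_i + 1). Then |D \ D_{(π,L)}| = 2^{m+r−2} and |D_{(π,L)} \ D| = 2^{m+r−2}; in particular |D| = |D_{(π,L)}|. -/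
/-- Dot product on `𝔽₂^m`. -/
def dotp {m : ℕ} (x y : Fin m → ZMod 2) : ZMod 2 := ∑ i, x i * y i

/-- `f : 𝔽₂^m × 𝔽₂^m → 𝔽₂` is bent: every Walsh–Hadamard coefficient is `±2^m`
(the dimension is `t = 2m`, so `2^{t/2} = 2^m`). -/
def IsBent2m {m : ℕ} (f : (Fin m → ZMod 2) × (Fin m → ZMod 2) → ZMod 2) : Prop :=
  ∀ a : (Fin m → ZMod 2) × (Fin m → ZMod 2),
    (∑ z : (Fin m → ZMod 2) × (Fin m → ZMod 2),
        (-1 : ℤ) ^ ((f z + dotp a.1 z.1 + dotp a.2 z.2).val)) = 2 ^ m ∨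
    (∑ z : (Fin m → ZMod 2) × (Fin m → ZMod 2),
        (-1 : ℤ) ^ ((f z + dotp a.1 z.1 + dotp a.2 z.2).val)) = -2 ^ m

/-- Carlet's function `f_{(π,L)}(x,y) = x·π(y) + 1_{L^⊥}(x)`. -/
noncomputable def fpl {m : ℕ} (π : (Fin m → ZMod 2) → (Fin m → ZMod 2))
    (L : Set (Fin m → ZMod 2)) (z : (Fin m → ZMod 2) × (Fin m → ZMod 2)) : ZMod 2 :=
  dotp z.1 (π z.2) +
    ({y : Fin m → ZMod 2 | ∀ x ∈ L, dotp x y = 0}).indicator (fun _ => 1) z.1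

/-- The Maiorana–McFarland type bent function
`f(x,y) = ∑_{i=1}^m x_i y_i + ∏_{i=s+1}^m (x_i + 1)` (0-indexed coordinates). -/
def fM {m : ℕ} (s : ℕ) (z : (Fin m → ZMod 2) × (Fin m → ZMod 2)) : ZMod 2 :=
  dotp z.1 z.2 + ∏ i ∈ Finset.univ.filter (fun i : Fin m => s ≤ (i : ℕ)), (z.1 i + 1)

theorem ZMod.two_eq_zero_or_one (a : ZMod 2) : a = 0 ∨ a = 1 := by
  revert a; decide

theorem ZMod.two_prod_eq_one_iff {ι : Type*} (S : Finset ι) (g : ι → ZMod 2) :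
    ∏ i ∈ S, g i = 1 ↔ ∀ i ∈ S, g i = 1 := by
  refine ⟨fun h i hi => ?_, Finset.prod_eq_one⟩
  refine (ZMod.two_eq_zero_or_one _).resolve_left fun h0 => ?_
  rw [Finset.prod_eq_zero hi h0] at h
  exact zero_ne_one h

/-- Changing coordinate `k` of the second argument by `c` changes the dot product by `x k * c`. -/
theorem dotp_update_add {m : ℕ} (x y : Fin m → ZMod 2) (k : Fin m) (c : ZMod 2) :
    dotp x (Function.update y k (y k + c)) = dotp x y + x k * c := by
  have h : Function.update y k (y k + c) = y + Pi.single k c := by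
    ext i
    by_cases hi : i = k
    · subst hi; simp
    · simp [hi]
  simp [h, dotp, mul_add, Finset.sum_add_distrib, Pi.single_apply]

/-- The orthogonal of the vectors vanishing on the first `s` coordinates consists of the vectors
vanishing on the remaining ones. -/
theorem forall_dotp_eq_zero_iff {m : ℕ} (s : ℕ) (y : Fin m → ZMod 2) :
    (∀ x ∈ {x : Fin m → ZMod 2 | ∀ j : Fin m, (j : ℕ) < s → x j = 0}, dotp x y = 0) ↔
      ∀ i : Fin m, s ≤ (i : ℕ) → y i = 0 := by
  constructor
  · intro h i hi
    have := h (Pi.single i 1) fun j hj => Pi.single_eq_of_ne (by rintro rfl; omega) _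
    simpa [dotp, Pi.single_apply] using this
  · intro h x hx
    refine Finset.sum_eq_zero fun i _ => ?_
    rcases lt_or_ge (i : ℕ) s with hi | hi
    · rw [hx i hi, zero_mul]
    · rw [h i hi, mul_zero]

theorem indicator_orthogonal_eq_prod {m : ℕ} (s : ℕ) (y : Fin m → ZMod 2) :
    ({y : Fin m → ZMod 2 | ∀ x ∈ {x : Fin m → ZMod 2 | ∀ j : Fin m, (j : ℕ) < s → x j = 0},
        dotp x y = 0}).indicator (fun _ => (1 : ZMod 2)) y =
      ∏ i ∈ Finset.univ.filter (fun i : Fin m => s ≤ (i : ℕ)), (y i + 1) := by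
  simp only [forall_dotp_eq_zero_iff]
  by_cases h : ∀ i : Fin m, s ≤ (i : ℕ) → y i = 0
  · rw [Set.indicator_of_mem (by exact h), Finset.prod_eq_one]
    intro i hi
    rw [h i (Finset.mem_filter.1 hi).2, zero_add]
  · rw [Set.indicator_of_notMem (by exact h)]
    push Not at h
    obtain ⟨i, hi, hy⟩ := h
    refine (Finset.prod_eq_zero (Finset.mem_filter.2 ⟨Finset.mem_univ i, hi⟩) ?_).symm
    rw [(ZMod.two_eq_zero_or_one _).resolve_left hy]
    decide

theorem fpl_update_eq {m : ℕ} (s : ℕ) (k : Fin m) (p : (Fin m → ZMod 2) → ZMod 2)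
    (z : (Fin m → ZMod 2) × (Fin m → ZMod 2)) :
    fpl (fun x : Fin m → ZMod 2 => Function.update x k (x k + p x))
      {x : Fin m → ZMod 2 | ∀ j : Fin m, (j : ℕ) < s → x j = 0} z =
      fM s z + z.1 k * p z.2 := by
  rw [fpl, fM, dotp_update_add, indicator_orthogonal_eq_prod]
  ring

theorem card_filter_forall_eq_one {m : ℕ} (p : Fin m → Prop) [DecidablePred p] :
    (Finset.univ.filter (fun x : Fin m → ZMod 2 => ∀ i, p i → x i = 1)).card =
      2 ^ (Finset.univ.filter (fun i => ¬ p i)).card := by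
  have h : Finset.univ.filter (fun x : Fin m → ZMod 2 => ∀ i, p i → x i = 1) =
      Fintype.piFinset (fun i => if p i then {1} else Finset.univ) := by
    ext x
    simp only [Finset.mem_filter, Finset.mem_univ, true_and, Fintype.mem_piFinset]
    refine forall_congr' fun i => ?_
    by_cases hi : p i <;> simp [hi]
  rw [h, Fintype.card_piFinset]
  simp [apply_ite Finset.card, Finset.prod_ite, ZMod.card]

theorem card_filter_eq_one_and_forall_eq_one {m : ℕ} (r : ℕ) (hr : r ≤ m) (k : Fin m) :
    (Finset.univ.filter (fun z : (Fin m → ZMod 2) × (Fin m → ZMod 2) =>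
      z.1 k = 1 ∧ ∀ i : Fin m, r ≤ (i : ℕ) → z.2 i = 1)).card = 2 ^ (m - 1 + r) := by
  have h : Finset.univ.filter (fun z : (Fin m → ZMod 2) × (Fin m → ZMod 2) =>
      z.1 k = 1 ∧ ∀ i : Fin m, r ≤ (i : ℕ) → z.2 i = 1) =
      Finset.univ.filter (fun x : Fin m → ZMod 2 => ∀ i, i = k → x i = 1) ×ˢ
        Finset.univ.filter (fun y : Fin m → ZMod 2 => ∀ i : Fin m, r ≤ (i : ℕ) → y i = 1) := by
    ext z
    simp
  rw [h, Finset.card_product, card_filter_forall_eq_one (fun i => i = k),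
    card_filter_forall_eq_one (fun i : Fin m => r ≤ (i : ℕ)), pow_add]
  congr 2
  · rw [Finset.filter_ne' Finset.univ k, Finset.card_erase_of_mem (Finset.mem_univ k)]
    simp
  · simp [Fin.card_filter_val_lt, hr]

/-- with `D` the support of `f` and `D_{(π,L)}` the support of
`f_{(π,L)}`, one has `|D \ D_{(π,L)}| = |D_{(π,L)} \ D| = 2^{m+r−2}`; in particular
`|D| = |D_{(π,L)}|`. -/
theorem stmt_11 (m r s : ℕ) [NeZero m] (hm : 3 ≤ m) (hr : 1 ≤ r) (hrs : r ≤ s)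
    (hsm : s ≤ m - 2)
    (D Dpl : Finset ((Fin m → ZMod 2) × (Fin m → ZMod 2)))
    (hD : D = Finset.univ.filter (fun z => fM s z = 1))
    (hDpl : Dpl = Finset.univ.filter (fun z =>
      fpl (fun x : Fin m → ZMod 2 => Function.update x 0
        (x 0 + ∏ i ∈ Finset.univ.filter (fun i : Fin m => r ≤ (i : ℕ)), x i))
      {x : Fin m → ZMod 2 | ∀ j : Fin m, (j : ℕ) < s → x j = 0} z = 1)) :
    (D \ Dpl).card = 2 ^ (m + r - 2) ∧ (Dpl \ D).card = 2 ^ (m + r - 2) ∧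
      D.card = Dpl.card := by
  subst hD hDpl
  simp only [fpl_update_eq]
  set A : Finset ((Fin m → ZMod 2) × (Fin m → ZMod 2)) := Finset.univ.filter
    (fun z => z.1 0 = 1 ∧ ∀ i : Fin m, r ≤ (i : ℕ) → z.2 i = 1) with hA
  have key (z : (Fin m → ZMod 2) × (Fin m → ZMod 2)) :
      (z ∈ A ↔ z.1 0 * ∏ i ∈ Finset.univ.filter (fun i : Fin m => r ≤ (i : ℕ)), z.2 i = 1) := by
    have h := ZMod.two_prod_eq_one_iff (Finset.univ.filter (fun i : Fin m => r ≤ (i : ℕ))) z.2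
    simp only [Finset.mem_filter, Finset.mem_univ, true_and] at h
    rw [hA, Finset.mem_filter, ← h]
    generalize z.1 0 = a, ∏ i ∈ Finset.univ.filter (fun i : Fin m => r ≤ (i : ℕ)), z.2 i = b
    revert a b
    simp only [Finset.mem_univ, true_and]
    decide
  have h₁ : Finset.univ.filter (fun z => fM s z = 1) \ Finset.univ.filter (fun z => fM s z +
      z.1 0 * ∏ i ∈ Finset.univ.filter (fun i : Fin m => r ≤ (i : ℕ)), z.2 i = 1) =
      A.filter (fun z => fM s z = 1) := by
    ext z
    simp only [Finset.mem_sdiff, Finset.mem_filter, Finset.mem_univ, true_and, key]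
    generalize z.1 0 * ∏ i ∈ Finset.univ.filter (fun i : Fin m => r ≤ (i : ℕ)), z.2 i = a,
      fM s z = b
    revert a b
    decide
  have h₂ : Finset.univ.filter (fun z => fM s z +
      z.1 0 * ∏ i ∈ Finset.univ.filter (fun i : Fin m => r ≤ (i : ℕ)), z.2 i = 1) \
      Finset.univ.filter (fun z => fM s z = 1) = A.filter (fun z => ¬ fM s z = 1) := by
    ext z
    simp only [Finset.mem_sdiff, Finset.mem_filter, Finset.mem_univ, true_and, key]
    generalize z.1 0 * ∏ i ∈ Finset.univ.filter (fun i : Fin m => r ≤ (i : ℕ)), z.2 i = a,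
      fM s z = b
    revert a b
    decide
  let flip (z : (Fin m → ZMod 2) × (Fin m → ZMod 2)) : (Fin m → ZMod 2) × (Fin m → ZMod 2) :=
    (z.1, Function.update z.2 0 (z.2 0 + 1))
  have flip_flip (z) : flip (flip z) = z := by
    have h : z.2 0 + 1 + 1 = z.2 0 := by generalize z.2 0 = a; revert a; decide
    simp [flip, h]
  have flip_mem (z) (hz : z ∈ A) : flip z ∈ A := by
    simp only [hA, Finset.mem_filter, Finset.mem_univ, true_and, flip] at hz ⊢
    refine ⟨hz.1, fun i hi => ?_⟩
    rw [Function.update_of_ne (by rintro rfl; simp at hi; omega)]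
    exact hz.2 i hi
  have fM_flip (z) (hz : z ∈ A) : fM s (flip z) = fM s z + 1 := by
    have h : z.1 0 = 1 := (Finset.mem_filter.1 hz).2.1
    simp only [fM, flip, dotp_update_add, h]
    ring
  have hcard : (A.filter (fun z => fM s z = 1)).card = (A.filter (fun z => ¬ fM s z = 1)).card := by
    refine Finset.card_nbij' flip flip ?_ ?_ (fun z _ => flip_flip z) (fun z _ => flip_flip z) <;>
    · intro z hz
      have hz := Finset.mem_filter.1 hz
      refine Finset.mem_filter.2 ⟨flip_mem z hz.1, ?_⟩
      have h := hz.2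
      rw [fM_flip z hz.1]
      revert h
      generalize fM s z = b
      revert b
      decide
  have hsum := Finset.card_filter_add_card_filter_not (s := A) (fun z => fM s z = 1)
  rw [hA, card_filter_eq_one_and_forall_eq_one r (by omega) 0, ← hA,
    show m - 1 + r = m + r - 2 + 1 by omega, pow_succ] at hsum
  rw [h₁, h₂]
  refine ⟨by omega, by omega, Finset.card_sdiff_eq_card_sdiff_iff.1 ?_⟩
  rw [h₁, h₂, hcard]
end

section
/- Let m ≥ 3 and 1 ≤ r ≤ s ≤ m−2 be integers, let L = {(0,…,0,x_{s+1},…,x_m) : x_i ∈ 𝔽₂} ⊆ 𝔽₂^m (first s coordinates zero), let π(x₁,…,x_m) = (x₁ + ∏_{i=r+1}^{m} x_i, x₂,…,x_m), let D_{(π,L)} ⊆ 𝔽₂^{2m} be the support of f_{(π,L)} and D ⊆ 𝔽₂^{2m} the support of f(x,y) = ∑_{i=1}^{m} x_i y_i + ∏_{i=s+1}^{m}(x_i + 1). Let ξ = (ξ₁,…,ξ_m) with ξ₁ = ⋯ = ξ_r = 1, ξ_{r+1} = ⋯ = ξ_s = −1, ξ_{s+1} = ⋯ = ξ_m = 1,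 and η = (η₁,…,η_m) with η₁ = −1, η₂ = ⋯ = η_m = 1. Then Δ(D, D_{(π,L)})(ξ, η) = 2^{s+1}. -/
/-- `ρ(T)(ξ,η) = ∑_{(x,y) ∈ T} ∏ ξ_i^{x_i*} ∏ η_i^{y_i*}`. -/
noncomputable def rhoPair {m : ℕ} (T : Finset ((Fin m → ZMod 2) × (Fin m → ZMod 2)))
    (ξ η : Fin m → ℂ) : ℂ :=
  ∑ z ∈ T, (∏ i, ξ i ^ ((z.1 i).val)) * (∏ i, η i ^ ((z.2 i).val))

/-- The embedding of `𝔽₂` into `ℂ` as the multiplicative monoid `{0, 1}`. -/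
noncomputable def bitHom : ZMod 2 →* ℂ where
  toFun u := if u = 1 then 1 else 0
  map_one' := by simp
  map_mul' := by
    have key : ∀ u v : ZMod 2, u * v = 1 ↔ u = 1 ∧ v = 1 := by decide
    intro u v
    simp only [key]
    split_ifs <;> simp_all

theorem bitHom_apply (u : ZMod 2) : bitHom u = if u = 1 then 1 else 0 := rfl

theorem neg_one_pow_val_add (u v : ZMod 2) :
    (-1 : ℂ) ^ (u + v).val = (-1) ^ u.val * (-1) ^ v.val := by
  rw [ZMod.val_add, ← pow_add, ← neg_one_pow_eq_pow_mod_two]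

theorem neg_one_pow_val_sum {ι : Type*} (t : Finset ι) (f : ι → ZMod 2) :
    (-1 : ℂ) ^ (∑ i ∈ t, f i).val = ∏ i ∈ t, (-1) ^ (f i).val := by
  classical
  induction t using Finset.induction_on with
  | empty => simp
  | insert a t ha ih => rw [Finset.sum_insert ha, Finset.prod_insert ha, neg_one_pow_val_add, ih]

theorem sum_prod_pair {m : ℕ} (a : Fin m → ZMod 2 → ZMod 2 → ℂ) :
    ∑ z : (Fin m → ZMod 2) × (Fin m → ZMod 2), ∏ i, a i (z.1 i) (z.2 i) =
      ∏ i, ∑ u, ∑ v, a i u v := by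
  rw [← (Equiv.arrowProdEquivProdArrow (Fin m) (fun _ => ZMod 2) (fun _ => ZMod 2)).sum_comp]
  simp only [← Fintype.sum_prod_type']
  rw [Finset.prod_univ_sum, Fintype.piFinset_univ]
  rfl

theorem dotp_update {m : ℕ} (x y : Fin m → ZMod 2) (j : Fin m) (p : ZMod 2) :
    dotp x (Function.update y j (y j + p)) = dotp x y + x j * p := by
  have h : ∀ i, x i * Function.update y j (y j + p) i =
      x i * y i + if i = j then x j * p else 0 := by
    intro i
    rcases eq_or_ne i j with rfl | h
    · simp [mul_add]
    · simp [h]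
  simp [dotp, h, Finset.sum_add_distrib]

theorem indicator_dual_eq_prod {m : ℕ} (s : ℕ) (x : Fin m → ZMod 2) :
    ({y : Fin m → ZMod 2 | ∀ l ∈ {l : Fin m → ZMod 2 | ∀ j : Fin m, (j : ℕ) < s → l j = 0},
        dotp l y = 0}).indicator (fun _ => (1 : ZMod 2)) x =
      ∏ i ∈ Finset.univ.filter (fun i : Fin m => s ≤ (i : ℕ)), (x i + 1) := by
  by_cases hx : ∀ i : Fin m, s ≤ (i : ℕ) → x i = 0
  · rw [Set.indicator_of_mem, Finset.prod_eq_one]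
    · intro i hi
      simp [hx i (by simpa using hi)]
    · intro l hl
      refine Finset.sum_eq_zero fun i _ => ?_
      rcases lt_or_ge (i : ℕ) s with h | h
      · simp [hl i h]
      · simp [hx i h]
  · push Not at hx
    obtain ⟨i, hi, hxi⟩ := hx
    have hxi1 : x i + 1 = 0 := by
      revert hxi
      generalize x i = u
      revert u
      decide
    rw [Set.indicator_of_notMem,
      Finset.prod_eq_zero (i := i) (by simpa using hi) hxi1]
    intro h
    refine hxi ?_
    have := h (Pi.single i 1) (fun j hj => Pi.single_eq_of_ne (by rintro rfl; omega) _)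
    simpa [dotp, Pi.single_apply] using this

theorem ite_sub_ite_eq (c x p q : ZMod 2) :
    (if c + q = 1 then (1 : ℂ) else 0) - (if c + x * p + q = 1 then 1 else 0) =
      (-1) ^ c.val * bitHom x * bitHom p * (2 * bitHom q - 1) := by
  have h : ∀ c x p q : ZMod 2,
      (if c + q = 1 then (1 : ℤ) else 0) - (if c + x * p + q = 1 then 1 else 0) =
        (-1) ^ c.val * (if x = 1 then 1 else 0) * (if p = 1 then 1 else 0) *
          (2 * (if q = 1 then 1 else 0) - 1) := by decide
  simp only [bitHom_apply]
  exact_mod_cast congrArg (Int.cast : ℤ → ℂ) (h c x p q)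

theorem prod_ite_bitHom {m : ℕ} (P : Fin m → Prop) [DecidablePred P] (f : Fin m → ZMod 2) :
    ∏ i, (if P i then bitHom (f i) else 1) = bitHom (∏ i ∈ Finset.univ.filter P, f i) := by
  rw [map_prod, Finset.prod_filter]

theorem sum_zmod_two (f : ZMod 2 → ℂ) : ∑ u, f u = f 0 + f 1 := Fin.sum_univ_two f

/-- for `ξ = (1,…,1,−1,…,−1,1,…,1)` (entries `r+1,…,s` equal `−1`)
and `η = (−1,1,…,1)`, one has `Δ(D, D_{(π,L)})(ξ,η) = 2^{s+1}`.
(Coordinates are 0-indexed: `ξ_i = −1` iff `r ≤ i < s` in 0-indexing.) -/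
theorem stmt_12 (m r s : ℕ) [NeZero m] (hm : 3 ≤ m) (hr : 1 ≤ r) (hrs : r ≤ s)
    (hsm : s ≤ m - 2)
    (D Dpl : Finset ((Fin m → ZMod 2) × (Fin m → ZMod 2)))
    (hD : D = Finset.univ.filter (fun z => fM s z = 1))
    (hDpl : Dpl = Finset.univ.filter (fun z =>
      fpl (fun x : Fin m → ZMod 2 => Function.update x 0
        (x 0 + ∏ i ∈ Finset.univ.filter (fun i : Fin m => r ≤ (i : ℕ)), x i))
      {x : Fin m → ZMod 2 | ∀ j : Fin m, (j : ℕ) < s → x j = 0} z = 1))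
    (ξ η : Fin m → ℂ)
    (hξ : ξ = fun i : Fin m => if r ≤ (i : ℕ) ∧ (i : ℕ) < s then (-1 : ℂ) else 1)
    (hη : η = fun i : Fin m => if (i : ℕ) = 0 then (-1 : ℂ) else 1) :
    rhoPair D ξ η - rhoPair Dpl ξ η = 2 ^ (s + 1) := by
  have h0 : ((0 : Fin m) : ℕ) = 0 := Fin.val_zero m
  set a : Fin m → ZMod 2 → ZMod 2 → ℂ := fun i u v =>
    ξ i ^ u.val * η i ^ v.val * (-1) ^ (u * v).val * (if i = 0 then bitHom u else 1) *
      (if r ≤ (i : ℕ) then bitHom v else 1) with ha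
  set b : Fin m → ZMod 2 → ZMod 2 → ℂ := fun i u v =>
    a i u v * (if s ≤ (i : ℕ) then bitHom (u + 1) else 1) with hb
  have hΔ : rhoPair D ξ η - rhoPair Dpl ξ η =
      2 * ∏ i, ∑ u, ∑ v, b i u v - ∏ i, ∑ u, ∑ v, a i u v := by
    rw [← sum_prod_pair, ← sum_prod_pair, Finset.mul_sum, ← Finset.sum_sub_distrib]
    simp only [rhoPair, hD, hDpl, Finset.sum_filter]
    rw [← Finset.sum_sub_distrib]
    refine Finset.sum_congr rfl fun z _ => ?_
    have hx0 : ∏ i : Fin m, (if i = 0 then bitHom (z.1 i) else 1) = bitHom (z.1 0) := by simp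
    simp only [hb, ha, Finset.prod_mul_distrib, hx0, prod_ite_bitHom, ← neg_one_pow_val_sum]
    rw [show fM s z = dotp z.1 z.2 +
        ∏ i ∈ Finset.univ.filter (fun i : Fin m => s ≤ (i : ℕ)), (z.1 i + 1) from rfl]
    rw [fpl, dotp_update, indicator_dual_eq_prod]
    have key := ite_sub_ite_eq (dotp z.1 z.2) (z.1 0)
      (∏ i ∈ Finset.univ.filter (fun i : Fin m => r ≤ (i : ℕ)), z.2 i)
      (∏ i ∈ Finset.univ.filter (fun i : Fin m => s ≤ (i : ℕ)), (z.1 i + 1))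
    rw [← mul_boole, ← mul_boole (_ + _ + _ = _), ← mul_sub, key]
    simp only [dotp]
    ring
  have hA : ∏ i, ∑ u, ∑ v, a i u v = 0 := by
    refine Finset.prod_eq_zero (Finset.mem_univ (⟨m - 1, by omega⟩ : Fin m)) ?_
    have h1 : (⟨m - 1, by omega⟩ : Fin m) ≠ 0 := by
      rw [Ne, Fin.ext_iff, h0]; simp only; omega
    have h2 : r ≤ m - 1 := by omega
    have h3 : ¬ m - 1 < s := by omega
    simp [ha, hξ, hη, h1, h2, h3, sum_zmod_two, bitHom_apply, ZMod.val_one]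
  have hB : ∀ i : Fin m, ∑ u, ∑ v, b i u v = if (i : ℕ) < s then 2 else 1 := by
    intro i
    have hi0 : i = 0 ↔ (i : ℕ) = 0 := by rw [Fin.ext_iff, h0]
    have h11 : (1 : ZMod 2) + 1 = 0 := by decide
    simp only [hb, ha, hξ, hη, hi0, sum_zmod_two, bitHom_apply, ZMod.val_one, h11]
    by_cases h1 : (i : ℕ) = 0
    · have h2 : ¬ r ≤ 0 := by omega
      have h3 : ¬ s ≤ 0 := by omega
      have h4 : 0 < s := by omega
      simp [h1, h2, h3, h4, ZMod.val_one]
      norm_num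
    by_cases h2 : (i : ℕ) < r
    · have h3 : ¬ r ≤ (i : ℕ) := by omega
      have h4 : ¬ s ≤ (i : ℕ) := by omega
      have h5 : (i : ℕ) < s := by omega
      simp [h1, h3, h4, h5, ZMod.val_one]
      norm_num
    have h3 : r ≤ (i : ℕ) := by omega
    by_cases h4 : (i : ℕ) < s
    · have h5 : ¬ s ≤ (i : ℕ) := by omega
      simp [h1, h3, h4, h5, ZMod.val_one]
      norm_num
    · have h5 : s ≤ (i : ℕ) := by omega
      simp [h1, h3, h4, h5, ZMod.val_one]
  have hcard : (Finset.univ.filter (fun i : Fin m => (i : ℕ) < s)).card = s := by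
    rw [Fin.card_filter_val_lt]
    omega
  rw [hΔ, hA, sub_zero, Finset.prod_congr rfl fun i _ => hB i, ← Finset.prod_filter,
    Finset.prod_const, hcard, pow_succ']
end

section
/- Let t > 2 be an even integer. The number of bent functions f : 𝔽₂^t → 𝔽₂ equals twice the number of (2^t, 2^{t−1} + 2^{(t−2)/2}, 2^{t−2} + 2^{(t−2)/2})-difference sets in the group (ℤ/2ℤ)^t. -/
/-- `f : 𝔽₂^t → 𝔽₂` is bent: every Walsh–Hadamard coefficient equals `±2^{t/2}`. -/
def IsBentT {t : ℕ} (f : (Fin t → ZMod 2) → ZMod 2) : Prop :=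
  ∀ a : Fin t → ZMod 2,
    (∑ x : Fin t → ZMod 2, (-1 : ℤ) ^ ((f x + ∑ i, a i * x i).val)) = 2 ^ (t / 2) ∨
    (∑ x : Fin t → ZMod 2, (-1 : ℤ) ^ ((f x + ∑ i, a i * x i).val)) = -2 ^ (t / 2)

/-- The sign `(-1)^z` of a bit `z`. -/
def bitSign (z : ZMod 2) : ℤ := (-1) ^ z.val

lemma bitSign_add (a b : ZMod 2) : bitSign (a + b) = bitSign a * bitSign b := by
  revert a b; decide

lemma bitSign_mul_self (a : ZMod 2) : bitSign a * bitSign a = 1 := by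
  revert a; decide

lemma bitSign_add_one (a : ZMod 2) : bitSign (a + 1) = -bitSign a := by
  revert a; decide

lemma one_sub_bitSign (a : ZMod 2) : 1 - bitSign a = 2 * if a = 1 then 1 else 0 := by
  revert a; decide

/-- The Walsh–Hadamard coefficient of `f` at `a`. -/
def walshCoeff {t : ℕ} (f : (Fin t → ZMod 2) → ZMod 2) (a : Fin t → ZMod 2) : ℤ :=
  ∑ x, bitSign (f x + a ⬝ᵥ x)

/-- The autocorrelation of the sign function of `f` at the shift `g`. -/
def autocorr {t : ℕ} (f : (Fin t → ZMod 2) → ZMod 2) (g : Fin t → ZMod 2) : ℤ :=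
  ∑ x, bitSign (f x) * bitSign (f (x + g))

/-- The support of a Boolean function. -/
def boolSupport {t : ℕ} (f : (Fin t → ZMod 2) → ZMod 2) : Finset (Fin t → ZMod 2) :=
  Finset.univ.filter fun x => f x = 1

lemma isBentT_iff_walshCoeff {t : ℕ} (f : (Fin t → ZMod 2) → ZMod 2) :
    IsBentT f ↔ ∀ a, walshCoeff f a = 2 ^ (t / 2) ∨ walshCoeff f a = -2 ^ (t / 2) :=
  Iff.rfl

lemma sum_bitSign_dotProduct {t : ℕ} {g : Fin t → ZMod 2} (hg : g ≠ 0) :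
    ∑ a : Fin t → ZMod 2, bitSign (a ⬝ᵥ g) = 0 := by
  obtain ⟨i, hi⟩ := Function.ne_iff.mp hg
  have h1 : g i = 1 := by
    rw [Pi.zero_apply] at hi
    revert hi
    generalize g i = z
    revert z
    decide
  have h := Equiv.sum_comp (Equiv.addRight (Pi.single i (1 : ZMod 2)))
    (fun a : Fin t → ZMod 2 => bitSign (a ⬝ᵥ g))
  simp only [Equiv.coe_addRight, add_dotProduct, single_dotProduct, one_mul, h1,
    bitSign_add_one, Finset.sum_neg_distrib] at h
  linarith

lemma walshCoeff_sq {t : ℕ} (f : (Fin t → ZMod 2) → ZMod 2) (a : Fin t → ZMod 2) :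
    walshCoeff f a ^ 2 = ∑ g, autocorr f g * bitSign (a ⬝ᵥ g) := by
  rw [walshCoeff, sq, Finset.sum_mul_sum]
  simp only [autocorr, Finset.sum_mul]
  conv_rhs => rw [Finset.sum_comm]
  refine Finset.sum_congr rfl fun x _ => ?_
  rw [← Equiv.sum_comp (Equiv.addLeft x)]
  refine Finset.sum_congr rfl fun g _ => ?_
  simp only [Equiv.coe_addLeft, bitSign_add, dotProduct_add]
  linear_combination bitSign (f x) * bitSign (f (x + g)) * bitSign (a ⬝ᵥ g) *
    bitSign_mul_self (a ⬝ᵥ x)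

lemma autocorr_zero {t : ℕ} (f : (Fin t → ZMod 2) → ZMod 2) : autocorr f 0 = 2 ^ t := by
  simp [autocorr, bitSign_mul_self]

lemma sum_walshCoeff_sq {t : ℕ} (f : (Fin t → ZMod 2) → ZMod 2) (g : Fin t → ZMod 2) :
    ∑ a, walshCoeff f a ^ 2 * bitSign (a ⬝ᵥ g) = 2 ^ t * autocorr f g := by
  simp only [walshCoeff_sq, Finset.sum_mul]
  rw [Finset.sum_comm, Finset.sum_eq_single g]
  · simp [mul_assoc, bitSign_mul_self]
  · intro h _ hne
    have hz : h + g ≠ 0 := fun h0 => hne (by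
      rw [eq_neg_of_add_eq_zero_left h0]
      funext i
      exact ZMod.neg_eq_self_mod_two (g i))
    simp only [mul_assoc, ← bitSign_add, ← dotProduct_add, ← Finset.mul_sum,
      sum_bitSign_dotProduct hz, mul_zero]
  · simp

lemma isBentT_iff_autocorr {t : ℕ} (ht : Even t) (f : (Fin t → ZMod 2) → ZMod 2) :
    IsBentT f ↔ ∀ g, g ≠ 0 → autocorr f g = 0 := by
  have hpow : (2 : ℤ) ^ t = (2 ^ (t / 2)) ^ 2 := by
    rw [← pow_mul, Nat.div_mul_cancel ht.two_dvd]
  rw [isBentT_iff_walshCoeff]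
  simp only [← sq_eq_sq_iff_eq_or_eq_neg, ← hpow]
  constructor
  · intro h g hg
    have hs := sum_walshCoeff_sq f g
    simp only [h, ← Finset.mul_sum, sum_bitSign_dotProduct hg, mul_zero] at hs
    simpa using hs.symm
  · intro h a
    rw [walshCoeff_sq, Finset.sum_eq_single 0 (fun g _ hg => by rw [h g hg, zero_mul]) (by simp),
      autocorr_zero]
    simp [bitSign]

lemma walshCoeff_zero {t : ℕ} (f : (Fin t → ZMod 2) → ZMod 2) :
    walshCoeff f 0 = 2 ^ t - 2 * (boolSupport f).card := by
  have h : ∑ x, (1 - bitSign (f x)) = 2 * ((boolSupport f).card : ℤ) := by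
    simp only [one_sub_bitSign, ← Finset.mul_sum, boolSupport, Finset.sum_boole]
  simp only [Finset.sum_sub_distrib, Finset.sum_const, Finset.card_univ, Fintype.card_pi,
    ZMod.card, Finset.prod_const, Fintype.card_fin] at h
  simp only [walshCoeff, zero_dotProduct, add_zero]
  simp at h
  linarith

lemma card_filter_sub_eq {t : ℕ} (D : Finset (Fin t → ZMod 2)) (g : Fin t → ZMod 2) :
    ((D ×ˢ D).filter (fun p => p.1 - p.2 = g)).card =
      (Finset.univ.filter fun x => x ∈ D ∧ x + g ∈ D).card := by
  refine Finset.card_nbij' (fun p => p.2) (fun x => (x + g, x)) ?_ ?_ ?_ ?_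
  · rintro ⟨x, y⟩ h
    simp only [Finset.coe_filter, Finset.mem_product, Set.mem_ofPred_eq, Finset.mem_univ,
      true_and] at h ⊢
    obtain ⟨⟨hx, hy⟩, rfl⟩ := h
    simpa using ⟨hy, hx⟩
  · intro x h
    simpa [and_comm] using h
  · rintro ⟨x, y⟩ h
    simp only [Finset.coe_filter, Set.mem_ofPred_eq] at h
    simp [← h.2]
  · intro x _
    rfl

lemma four_mul_card_filter_sub_eq {t : ℕ} (f : (Fin t → ZMod 2) → ZMod 2) (g : Fin t → ZMod 2) :
    4 * (((boolSupport f ×ˢ boolSupport f).filter (fun p => p.1 - p.2 = g)).card : ℤ) =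
      2 ^ t - 2 * walshCoeff f 0 + autocorr f g := by
  have hshift : ∑ x, bitSign (f (x + g)) = ∑ x, bitSign (f x) :=
    Equiv.sum_comp (Equiv.addRight g) fun x => bitSign (f x)
  have hprod : ∑ x, (1 - bitSign (f x)) * (1 - bitSign (f (x + g))) =
      2 ^ t - 2 * walshCoeff f 0 + autocorr f g := by
    simp only [sub_mul, mul_sub, one_mul, mul_one, Finset.sum_sub_distrib, hshift, walshCoeff,
      zero_dotProduct, add_zero, autocorr]
    simp
    ring
  rw [← hprod, card_filter_sub_eq, Finset.card_filter]
  push_cast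
  rw [Finset.mul_sum]
  refine Finset.sum_congr rfl fun x _ => ?_
  simp only [one_sub_bitSign, boolSupport, Finset.mem_filter, Finset.mem_univ, true_and]
  split_ifs <;> simp_all

lemma isDiffSet2_boolSupport_iff {t : ℕ} (ht : Even t) (ht2 : 2 ≤ t)
    (f : (Fin t → ZMod 2) → ZMod 2) :
    IsDiffSet2 (2 ^ (t - 1) + 2 ^ ((t - 2) / 2)) (2 ^ (t - 2) + 2 ^ ((t - 2) / 2))
      (boolSupport f) ↔ IsBentT f ∧ walshCoeff f 0 = -2 ^ (t / 2) := by
  have h1 : (2 : ℤ) ^ t = 4 * 2 ^ (t - 2) := by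
    obtain ⟨n, rfl⟩ := Nat.exists_eq_add_of_le' ht2
    simp [pow_add, mul_comm]
  have h2 : (2 : ℤ) ^ (t - 1) = 2 * 2 ^ (t - 2) := by
    obtain ⟨n, rfl⟩ := Nat.exists_eq_add_of_le' ht2
    simp [pow_add, mul_comm]
  have h3 : (2 : ℤ) ^ (t / 2) = 2 * 2 ^ ((t - 2) / 2) := by
    rw [← pow_succ', show t / 2 = (t - 2) / 2 + 1 by omega]
  rw [isBentT_iff_autocorr ht, IsDiffSet2, and_comm]
  have hcard : (boolSupport f).card = 2 ^ (t - 1) + 2 ^ ((t - 2) / 2) ↔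
      walshCoeff f 0 = -2 ^ (t / 2) := by
    rw [walshCoeff_zero]
    zify
    constructor <;> intro h <;> linarith
  rw [hcard]
  refine and_congr_left fun hw => forall₂_congr fun g _ => ?_
  have hg := four_mul_card_filter_sub_eq f g
  zify
  constructor <;> intro h <;> linarith

lemma boolSupport_injective {t : ℕ} :
    Function.Injective (boolSupport : ((Fin t → ZMod 2) → ZMod 2) → _) := by
  intro f g h
  funext x
  have hx : f x = 1 ↔ g x = 1 := by simpa [boolSupport] using Finset.ext_iff.mp h x
  revert hx
  generalize f x = a
  generalize g x = b
  revert a b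
  decide

lemma boolSupport_surjective {t : ℕ} :
    Function.Surjective (boolSupport : ((Fin t → ZMod 2) → ZMod 2) → _) := fun D =>
  ⟨fun x => if x ∈ D then 1 else 0, by ext x; simp [boolSupport]⟩

lemma walshCoeff_add_one {t : ℕ} (f : (Fin t → ZMod 2) → ZMod 2) (a : Fin t → ZMod 2) :
    walshCoeff (f + 1) a = -walshCoeff f a := by
  simp only [walshCoeff, Pi.add_apply, Pi.one_apply, add_right_comm _ (1 : ZMod 2),
    bitSign_add_one, Finset.sum_neg_distrib]

lemma IsBentT.add_one {t : ℕ} {f : (Fin t → ZMod 2) → ZMod 2} (hf : IsBentT f) :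
    IsBentT (f + 1) := by
  rw [isBentT_iff_walshCoeff] at hf ⊢
  intro a
  rw [walshCoeff_add_one]
  rcases hf a with h | h <;> simp [h]

/-- for even `t > 2`, the number of bent functions on `𝔽₂^t` is twice the
number of `(2^t, 2^{t−1} + 2^{(t−2)/2}, 2^{t−2} + 2^{(t−2)/2})`-difference sets in
`(ℤ/2ℤ)^t`. -/
theorem stmt_19 (t : ℕ) (ht : Even t) (ht2 : 2 < t) :
    {f : (Fin t → ZMod 2) → ZMod 2 | IsBentT f}.ncard =
      2 * {D : Finset (Fin t → ZMod 2) |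
        IsDiffSet2 (2 ^ (t - 1) + 2 ^ ((t - 2) / 2)) (2 ^ (t - 2) + 2 ^ ((t - 2) / 2)) D}.ncard := by
  set S : Set (Finset (Fin t → ZMod 2)) := {D |
    IsDiffSet2 (2 ^ (t - 1) + 2 ^ ((t - 2) / 2)) (2 ^ (t - 2) + 2 ^ ((t - 2) / 2)) D}
  set N : Set ((Fin t → ZMod 2) → ZMod 2) := {f | IsBentT f ∧ walshCoeff f 0 = -2 ^ (t / 2)}
  have hN : N.ncard = S.ncard := by
    have hpre : N = boolSupport ⁻¹' S :=
      Set.ext fun f => (isDiffSet2_boolSupport_iff ht ht2.le f).symm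
    rw [← Set.image_preimage_eq S boolSupport_surjective, ← hpre,
      Set.ncard_image_of_injective _ boolSupport_injective]
  have hadd : ∀ f : (Fin t → ZMod 2) → ZMod 2, f + 1 + 1 = f := fun f => by
    funext x
    simp [add_assoc, CharTwo.add_self_eq_zero]
  have hunion : {f : (Fin t → ZMod 2) → ZMod 2 | IsBentT f} = N ∪ (· + 1) '' N := by
    ext f
    constructor
    · intro hf
      rcases hf 0 with h | h
      · exact Or.inr ⟨f + 1, ⟨hf.add_one, (walshCoeff_add_one f 0).trans (congrArg _ h)⟩, hadd f⟩
      · exact Or.inl ⟨hf, h⟩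
    · rintro (hf | ⟨g, hg, rfl⟩)
      · exact hf.1
      · exact hg.1.add_one
  have hdisj : Disjoint N ((· + 1) '' N) := by
    rw [Set.disjoint_left]
    rintro _ hf ⟨g, hg, rfl⟩
    have h := hf.2
    rw [walshCoeff_add_one, hg.2] at h
    have hpos : (0 : ℤ) < 2 ^ (t / 2) := by positivity
    linarith
  rw [hunion, Set.ncard_union_eq hdisj (Set.toFinite _) (Set.toFinite _),
    Set.ncard_image_of_injective _ (add_left_injective 1), hN, two_mul]
end
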